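/- Let R be a commutative Noetherian ring of prime characteristic p, let G be an x-torsion-free R-module with Frobenius-semilinear endomorphism ξ, let c ∈ R and w₀ ∈ ℕ. Suppose v₀ ∈ ℕ has the property that for every g ∈ G: if c·ξ^{n₁}(g) = 0 for one single n₁ ≥ v₀, then c·ξ^n(g) = 0 for all n ∈ ℕ. Then v₀ + w₀ + 1 has the analogous property for the element c^{p^{w₀}+1}: for every g ∈ G, if c^{p^{w₀}+1}·ξ^{n₁}(g) = 0 for one single n₁ ≥ v₀ + w₀ + 1, then c^{p^{w₀}+1}·ξ^n(g) = 0 for all n ∈ ℕ. (In particular the Rc^{p^{w₀}+1}-stability index of G is at most v₀ + w₀ + 1.) -/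

import Mathlib

/-- The `j`-th iterate of a `p`-semilinear map is `p ^ j`-semilinear. -/
theorem iterate_smul_of_semilinear {R G : Type*} [Monoid R] [SMul R G] {p : ℕ} {ξ : G → G}
    (hsemi : ∀ (r : R) (g : G), ξ (r • g) = r ^ p • ξ g) (j : ℕ) (r : R) (g : G) :
    ξ^[j] (r • g) = r ^ p ^ j • ξ^[j] g := by
  induction j with
  | zero => simp
  | succ j ih => rw [Function.iterate_succ_apply', ih, hsemi, ← pow_mul, ← pow_succ,
      Function.iterate_succ_apply']

/-- Let `R` be a commutative Noetherian ring of prime characteristic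
`p`, let `G` be an `x`-torsion-free `R`-module with Frobenius-semilinear endomorphism `ξ`,
let `c ∈ R` and `w₀ ∈ ℕ`.  Suppose `v₀ ∈ ℕ` has the property that for every `g ∈ G`: if
`c • ξ^{n₁} g = 0` for one single `n₁ ≥ v₀`, then `c • ξ^n g = 0` for all `n ∈ ℕ`.
Then `v₀ + w₀ + 1` has the analogous property for the element `c^{p^{w₀}+1}`:  for
every `g ∈ G`, if `c^{p^{w₀}+1} • ξ^{n₁} g = 0` for one single `n₁ ≥ v₀ + w₀ + 1`, then
`c^{p^{w₀}+1} • ξ^n g = 0` for all `n ∈ ℕ`. -/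
theorem stmt11 (R : Type*) [CommRing R] [IsNoetherianRing R]
    (p : ℕ) (hp : p.Prime) [CharP R p]
    (G : Type*) [AddCommGroup G] [Module R G]
    (ξ : G → G)
    (hadd : ∀ a b : G, ξ (a + b) = ξ a + ξ b)
    (hsemi : ∀ (r : R) (g : G), ξ (r • g) = r ^ p • ξ g)
    (htf : ∀ g : G, (∃ j : ℕ, 0 < j ∧ ξ^[j] g = 0) → g = 0)
    (c : R) (w₀ : ℕ) (v₀ : ℕ)
    (hv₀ : ∀ g : G, ∀ n₁ : ℕ, v₀ ≤ n₁ → c • ξ^[n₁] g = 0 → ∀ n : ℕ, c • ξ^[n] g = 0) :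
    ∀ g : G, ∀ n₁ : ℕ, v₀ + w₀ + 1 ≤ n₁ → c ^ (p ^ w₀ + 1) • ξ^[n₁] g = 0 →
      ∀ n : ℕ, c ^ (p ^ w₀ + 1) • ξ^[n] g = 0 := by
  intro g n₁ hn₁ hg n
  have key : c • ξ^[n₁ - (w₀ + 1)] g = 0 := by
    refine htf _ ⟨w₀ + 1, w₀.succ_pos, ?_⟩
    have hle : p ^ w₀ + 1 ≤ p ^ (w₀ + 1) := Nat.pow_lt_pow_succ hp.one_lt
    rw [iterate_smul_of_semilinear hsemi, ← Function.iterate_add_apply,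
      Nat.add_sub_cancel' (by omega), ← Nat.sub_add_cancel hle, pow_add, mul_smul, hg, smul_zero]
  rw [pow_succ, mul_smul, hv₀ g _ (by omega) key n, smul_zero]
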